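/- Let D and C be the N×N matrices with rows indexed by θ ∈ θ_p and columns by θ' ∈ θ_a given by D_{θ,θ'} = e^{−i(l−1/2)(θ−θ')}/(2iN·sin((θ'−θ)/2)) · (√(b_{θ'})/√(b_θ) + √(b_θ)/√(b_{θ'})) and C_{θ,θ'} = e^{−i(l−1/2)(θ+θ')}/(2iN·sin((θ+θ')/2)) · (√(b_θ)√(b_{θ'}) − 1/(√(b_θ)√(b_{θ'}))). Then C·C† = 1 − D·D†, where † denotes the conjugate transpose and 1 is the N×N identity matrix. -/

import Mathlib

open Finset Matrix

noncomputable section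

/-- Antiperiodic momenta: θ_a = {(2j−1)π/N : j = 1,…,N}. -/
def thetaA (N : ℕ) (j : Fin N) : ℝ := (2 * (j : ℝ) + 1) * Real.pi / N

/-- Periodic momenta: θ_p = {2(j−1)π/N : j = 1,…,N}. -/
def thetaP (N : ℕ) (j : Fin N) : ℝ := (2 * (j : ℝ)) * Real.pi / N

/-- b_θ, the principal square root of
`(1−αe^{iθ})(1−βe^{−iθ}) / ((1−βe^{iθ})(1−αe^{−iθ}))`. -/
def bfun (α β θ : ℝ) : ℂ :=
  ((((1 : ℂ) - (α : ℂ) * Complex.exp (Complex.I * θ)) *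
      ((1 : ℂ) - (β : ℂ) * Complex.exp (-Complex.I * θ))) /
    (((1 : ℂ) - (β : ℂ) * Complex.exp (Complex.I * θ)) *
      ((1 : ℂ) - (α : ℂ) * Complex.exp (-Complex.I * θ)))) ^ ((2 : ℂ)⁻¹)

/-- √(b_θ), principal square root. -/
def sqb (α β θ : ℝ) : ℂ := bfun α β θ ^ ((2 : ℂ)⁻¹)

/-- The matrix D, rows indexed by θ ∈ θ_p, columns by θ' ∈ θ_a. -/
def Dmat (N : ℕ) (l : ℤ) (α β : ℝ) : Matrix (Fin N) (Fin N) ℂ :=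
  Matrix.of fun j k =>
    Complex.exp (-Complex.I * ((l : ℂ) - 2⁻¹) * ((thetaP N j : ℝ) - (thetaA N k : ℝ))) /
        (2 * Complex.I * N * Complex.sin ((((thetaA N k : ℝ) : ℂ) - (thetaP N j : ℝ)) / 2)) *
      (sqb α β (thetaA N k) / sqb α β (thetaP N j) +
        sqb α β (thetaP N j) / sqb α β (thetaA N k))

/-- The matrix C, rows indexed by θ ∈ θ_p, columns by θ' ∈ θ_a. -/
def Cmat (N : ℕ) (l : ℤ) (α β : ℝ) : Matrix (Fin N) (Fin N) ℂ :=
  Matrix.of fun j k =>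
    Complex.exp (-Complex.I * ((l : ℂ) - 2⁻¹) * ((thetaP N j : ℝ) + (thetaA N k : ℝ))) /
        (2 * Complex.I * N * Complex.sin ((((thetaP N j : ℝ) : ℂ) + (thetaA N k : ℝ)) / 2)) *
      (sqb α β (thetaP N j) * sqb α β (thetaA N k) -
        1 / (sqb α β (thetaP N j) * sqb α β (thetaA N k)))

/-- ν_θ = ln [∏_{θ'∈θ_a} sinh((γ_θ+γ_{θ'})/2) / ∏_{θ'∈θ_p} sinh((γ_θ+γ_{θ'})/2)]. -/
def nufun (N : ℕ) (γ : ℝ → ℝ) (θ : ℝ) : ℝ :=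
  Real.log ((∏ j : Fin N, Real.sinh ((γ θ + γ (thetaA N j)) / 2)) /
    (∏ j : Fin N, Real.sinh ((γ θ + γ (thetaP N j)) / 2)))

theorem sum_exp_two_pi_mul_div (N : ℕ) (d : ℤ) (hd : |d| < N) :
    ∑ k : Fin N, Complex.exp (Complex.I * (2 * Real.pi * d * (k : ℕ) / N)) =
      if d = 0 then (N : ℂ) else 0 := by
  split_ifs with h
  · simp [h]
  · have hN : (N : ℂ) ≠ 0 := by
      rintro h0
      have : N = 0 := by exact_mod_cast h0
      subst this
      exact absurd hd (not_lt.mpr (by simp))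
    set w := Complex.exp (Complex.I * (2 * Real.pi * d / N)) with hw
    have hsum : ∀ k : Fin N,
        Complex.exp (Complex.I * (2 * Real.pi * d * (k : ℕ) / N)) = w ^ (k : ℕ) := by
      intro k
      rw [hw, ← Complex.exp_nat_mul]
      congr 1
      ring
    have hwN : w ^ N = 1 := by
      rw [hw, ← Complex.exp_nat_mul, Complex.exp_eq_one_iff]
      exact ⟨d, by field_simp⟩
    have hw1 : w ≠ 1 := by
      rw [hw, Ne, Complex.exp_eq_one_iff]
      rintro ⟨n, hn⟩
      have hpi : (Real.pi : ℂ) ≠ 0 := by exact_mod_cast Real.pi_ne_zero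
      have hdn : (d : ℂ) = n * N := by
        field_simp at hn
        have h2 : (2 * Real.pi * Complex.I : ℂ) * d = 2 * Real.pi * Complex.I * (n * N) := by
          linear_combination (2 * Real.pi * Complex.I : ℂ) * hn
        exact mul_left_cancel₀ (by simp [hpi]) h2
      have hdn' : d = N * n := by
        rw [mul_comm]
        exact_mod_cast hdn
      exact h (Int.eq_zero_of_abs_lt_dvd ⟨n, hdn'⟩ hd)
    simp_rw [hsum]
    rw [Fin.sum_univ_eq_sum_range (fun k => w ^ k), geom_sum_eq hw1, hwN]
    simp

theorem inv_sin_half_eq_sum (N : ℕ) (x : ℂ) (hx : Complex.exp (Complex.I * x * N) = -1) :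
    (Complex.sin (x / 2))⁻¹ =
      -Complex.I * Complex.exp (Complex.I * x / 2) *
        ∑ n : Fin N, Complex.exp (Complex.I * x * (n : ℕ)) := by
  set u := Complex.exp (Complex.I * x / 2) with hu
  have hu0 : u ≠ 0 := Complex.exp_ne_zero _
  have huz : Complex.exp (Complex.I * x) = u ^ 2 := by
    rw [hu, ← Complex.exp_nat_mul]
    congr 1
    push_cast
    ring
  have hpow : ∀ n : ℕ, Complex.exp (Complex.I * x * n) = (u ^ 2) ^ n := by
    intro n
    rw [← huz, ← Complex.exp_nat_mul]
    congr 1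
    ring
  have hne : u ^ 2 ≠ 1 := by
    intro h
    rw [hpow, h, one_pow] at hx
    norm_num at hx
  have hsin : Complex.sin (x / 2) = (u⁻¹ - u) * Complex.I / 2 := by
    rw [Complex.sin, hu, ← Complex.exp_neg]
    congr 4 <;> ring_nf
  simp_rw [hpow]
  rw [Fin.sum_univ_eq_sum_range (fun k => (u ^ 2) ^ k), geom_sum_eq hne, ← hpow, hx, hsin]
  have h1 : u ^ 2 - 1 ≠ 0 := sub_ne_zero.mpr hne
  have h2 : u⁻¹ - u = -(u ^ 2 - 1) / u := by
    field_simp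
    ring
  rw [h2]
  refine inv_eq_of_mul_eq_one_right ?_
  field_simp
  rw [Complex.I_sq]
  norm_num

theorem exp_thetaA_sub_thetaP_mul (N : ℕ) (hN : 1 ≤ N) (j k : Fin N) :
    Complex.exp (Complex.I * ((thetaA N k : ℂ) - (thetaP N j : ℂ)) * N) = -1 := by
  have hN0 : (N : ℂ) ≠ 0 := by
    exact_mod_cast (by omega : N ≠ 0)
  have : Complex.I * ((thetaA N k : ℂ) - (thetaP N j : ℂ)) * N =
      Real.pi * Complex.I + ((k : ℤ) - (j : ℤ) : ℤ) * (2 * Real.pi * Complex.I) := by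
    simp only [thetaA, thetaP]
    push_cast
    field_simp
    ring
  rw [this, Complex.exp_add, Complex.exp_int_mul_two_pi_mul_I, Complex.exp_pi_mul_I, mul_one]

theorem sin_half_thetaA_sub_thetaP_ne_zero (N : ℕ) (hN : 1 ≤ N) (j k : Fin N) :
    Complex.sin (((thetaA N k : ℂ) - (thetaP N j : ℂ)) / 2) ≠ 0 := by
  intro h
  obtain ⟨n, hn⟩ := Complex.sin_eq_zero_iff.mp h
  have hexp := exp_thetaA_sub_thetaP_mul N hN j k
  have : Complex.I * ((thetaA N k : ℂ) - (thetaP N j : ℂ)) * N =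
      (n * N : ℤ) * (2 * Real.pi * Complex.I) := by
    push_cast
    linear_combination (2 * Complex.I * N) * hn
  rw [this, Complex.exp_int_mul_two_pi_mul_I] at hexp
  norm_num at hexp

theorem sum_inv_sin_mul_inv_sin (N : ℕ) (hN : 1 ≤ N) (j m : Fin N) :
    ∑ k : Fin N, (Complex.sin (((thetaA N k : ℂ) - (thetaP N j : ℂ)) / 2))⁻¹ *
        (Complex.sin (((thetaA N k : ℂ) - (thetaP N m : ℂ)) / 2))⁻¹ =
      if j = m then (N : ℂ) ^ 2 else 0 := by
  have hN0 : (N : ℂ) ≠ 0 := by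
    exact_mod_cast (by omega : N ≠ 0)
  set E := Complex.exp (Complex.I * ((thetaP N m : ℂ) - (thetaP N j : ℂ)) / 2) with hE
  have hterm : ∀ k : Fin N, (Complex.sin (((thetaA N k : ℂ) - (thetaP N j : ℂ)) / 2))⁻¹ *
        (Complex.sin (((thetaA N k : ℂ) - (thetaP N m : ℂ)) / 2))⁻¹ =
      E * ∑ n : Fin N, ∑ n' : Fin N,
        Complex.exp (Complex.I * ((thetaP N m : ℂ) * (n' : ℕ) - (thetaP N j : ℂ) * (n : ℕ) +
            Real.pi * (((n : ℕ) : ℤ) - ((n' : ℕ) : ℤ) : ℤ) / N)) *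
          Complex.exp (Complex.I *
            (2 * Real.pi * (((n : ℕ) : ℤ) - ((n' : ℕ) : ℤ) : ℤ) * (k : ℕ) / N)) := by
    intro k
    have h2 : Complex.exp (Complex.I * (-((thetaA N k : ℂ) - (thetaP N m : ℂ))) * N) = -1 := by
      have := exp_thetaA_sub_thetaP_mul N hN m k
      rw [mul_neg, neg_mul, Complex.exp_neg, this]
      norm_num
    have h3 := inv_sin_half_eq_sum N _ h2
    rw [neg_div, Complex.sin_neg, inv_neg, neg_eq_iff_eq_neg] at h3
    have hEs : E = Complex.exp (Complex.I * ((thetaA N k : ℂ) - (thetaP N j : ℂ)) / 2) *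
        Complex.exp (Complex.I * (-((thetaA N k : ℂ) - (thetaP N m : ℂ))) / 2) := by
      rw [hE, ← Complex.exp_add]
      congr 1
      ring
    have hsums : (∑ n : Fin N,
          Complex.exp (Complex.I * ((thetaA N k : ℂ) - (thetaP N j : ℂ)) * (n : ℕ))) *
        (∑ n : Fin N,
          Complex.exp (Complex.I * (-((thetaA N k : ℂ) - (thetaP N m : ℂ))) * (n : ℕ))) =
        ∑ n : Fin N, ∑ n' : Fin N,
        Complex.exp (Complex.I * ((thetaP N m : ℂ) * (n' : ℕ) - (thetaP N j : ℂ) * (n : ℕ) +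
            Real.pi * (((n : ℕ) : ℤ) - ((n' : ℕ) : ℤ) : ℤ) / N)) *
          Complex.exp (Complex.I *
            (2 * Real.pi * (((n : ℕ) : ℤ) - ((n' : ℕ) : ℤ) : ℤ) * (k : ℕ) / N)) := by
      rw [Finset.sum_mul_sum]
      refine Finset.sum_congr rfl fun n _ => Finset.sum_congr rfl fun n' _ => ?_
      rw [← Complex.exp_add, ← Complex.exp_add]
      congr 1
      simp only [thetaA]
      push_cast
      field_simp
      ring
    rw [inv_sin_half_eq_sum N _ (exp_thetaA_sub_thetaP_mul N hN j k), h3, ← hsums, hEs]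
    linear_combination (-(Complex.exp (Complex.I * ((thetaA N k : ℂ) - (thetaP N j : ℂ)) / 2) *
        Complex.exp (Complex.I * (-((thetaA N k : ℂ) - (thetaP N m : ℂ))) / 2) *
        (∑ n : Fin N,
          Complex.exp (Complex.I * ((thetaA N k : ℂ) - (thetaP N j : ℂ)) * (n : ℕ))) *
        (∑ n : Fin N,
          Complex.exp (Complex.I * (-((thetaA N k : ℂ) - (thetaP N m : ℂ))) * (n : ℕ)))))
        * Complex.I_sq
  have hinner : ∀ n n' : Fin N, (∑ k : Fin N, Complex.exp (Complex.I *
      (2 * Real.pi * (((n : ℕ) : ℤ) - ((n' : ℕ) : ℤ) : ℤ) * (k : ℕ) / N))) =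
      if n' = n then (N : ℂ) else 0 := by
    intro n n'
    rw [sum_exp_two_pi_mul_div N _ (by rw [abs_lt]; omega)]
    congr 1
    rw [Fin.ext_iff, eq_iff_iff]
    omega
  have houter : ∀ n : Fin N,
      Complex.exp (Complex.I * ((thetaP N m : ℂ) * (n : ℕ) - (thetaP N j : ℂ) * (n : ℕ) +
            Real.pi * (((n : ℕ) : ℤ) - ((n : ℕ) : ℤ) : ℤ) / N)) =
      Complex.exp (Complex.I *
        (2 * Real.pi * (((m : ℕ) : ℤ) - ((j : ℕ) : ℤ) : ℤ) * (n : ℕ) / N)) := by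
    intro n
    congr 1
    simp only [thetaP]
    push_cast
    field_simp
    ring
  simp_rw [hterm]
  rw [← Finset.mul_sum, Finset.sum_comm]
  have hswap : ∀ n : Fin N, (∑ k : Fin N, ∑ n' : Fin N,
        Complex.exp (Complex.I * ((thetaP N m : ℂ) * (n' : ℕ) - (thetaP N j : ℂ) * (n : ℕ) +
            Real.pi * (((n : ℕ) : ℤ) - ((n' : ℕ) : ℤ) : ℤ) / N)) *
          Complex.exp (Complex.I *
            (2 * Real.pi * (((n : ℕ) : ℤ) - ((n' : ℕ) : ℤ) : ℤ) * (k : ℕ) / N))) =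
      Complex.exp (Complex.I *
        (2 * Real.pi * (((m : ℕ) : ℤ) - ((j : ℕ) : ℤ) : ℤ) * (n : ℕ) / N)) * N := by
    intro n
    rw [Finset.sum_comm]
    simp_rw [← Finset.mul_sum, hinner, mul_ite, mul_zero]
    rw [Finset.sum_ite_eq', if_pos (Finset.mem_univ _), houter]
  simp_rw [hswap]
  rw [← Finset.sum_mul, sum_exp_two_pi_mul_div N _ (by rw [abs_lt]; omega)]
  by_cases hjm : j = m
  · subst hjm
    simp [hE]
    ring
  · rw [if_neg hjm, if_neg (by rw [Fin.ext_iff] at hjm; omega)]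
    simp

theorem tanh_strictMono : StrictMono Real.tanh := by
  intro x y hxy
  rw [Real.tanh_eq_sinh_div_cosh, Real.tanh_eq_sinh_div_cosh,
    div_lt_div_iff₀ (Real.cosh_pos x) (Real.cosh_pos y)]
  have h : 0 < Real.sinh (y - x) := Real.sinh_pos_iff.mpr (sub_pos.mpr hxy)
  rw [Real.sinh_sub] at h
  linarith

/-- The numerator of the ratio whose principal square root is `b_θ`. -/
def bnum (α β θ : ℝ) : ℂ :=
  ((1 : ℂ) - (α : ℂ) * Complex.exp (Complex.I * θ)) *
    ((1 : ℂ) - (β : ℂ) * Complex.exp (-Complex.I * θ))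

theorem bfun_eq (α β θ : ℝ) :
    bfun α β θ = (bnum α β θ / star (bnum α β θ)) ^ ((2 : ℂ)⁻¹) := by
  simp only [bfun, bnum, star_mul', star_sub, star_one, Complex.star_def, ← Complex.exp_conj,
    map_mul, map_neg, Complex.conj_I, Complex.conj_ofReal, neg_neg]
  rw [mul_comm ((1 : ℂ) - (α : ℂ) * Complex.exp (-Complex.I * θ))]

theorem bnum_two_pi_sub (α β θ : ℝ) :
    bnum α β (2 * Real.pi - θ) = star (bnum α β θ) := by
  have h1 : Complex.exp (Complex.I * ((2 * Real.pi - θ : ℝ) : ℂ)) =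
      Complex.exp (-Complex.I * θ) := by
    rw [Complex.exp_eq_exp_iff_exists_int]
    exact ⟨1, by push_cast; ring⟩
  have h2 : Complex.exp (-Complex.I * ((2 * Real.pi - θ : ℝ) : ℂ)) =
      Complex.exp (Complex.I * θ) := by
    rw [Complex.exp_eq_exp_iff_exists_int]
    exact ⟨-1, by push_cast; ring⟩
  simp only [bnum, h1, h2, star_mul', star_sub, star_one, Complex.star_def, ← Complex.exp_conj,
    map_mul, map_neg, Complex.conj_I, Complex.conj_ofReal, neg_neg]

theorem bnum_re_pos {α β : ℝ} (hα0 : 0 < α) (hα1 : α < 1) (hβ0 : 0 < β) (hβ1 : β < 1) (θ : ℝ) :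
    0 < (bnum α β θ).re := by
  have h : bnum α β θ = 1 + α * β - α * Complex.exp (θ * Complex.I) -
      β * Complex.exp ((-θ : ℝ) * Complex.I) := by
    have h1 : Complex.exp (θ * Complex.I) * Complex.exp ((-θ : ℝ) * Complex.I) = 1 := by
      rw [← Complex.exp_add, ← Complex.exp_zero]
      congr 1
      push_cast
      ring
    have h2 : Complex.I * (θ : ℂ) = θ * Complex.I := by ring
    have h3 : -Complex.I * (θ : ℂ) = (-θ : ℝ) * Complex.I := by
      push_cast
      ring
    rw [bnum, h2, h3]
    linear_combination (α * β : ℂ) * h1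
  have hre : (bnum α β θ).re = 1 + α * β - α * Real.cos θ - β * Real.cos θ := by
    rw [h]
    simp [Complex.exp_ofReal_mul_I_re, -Complex.ofReal_neg]
  rw [hre]
  have hc := Real.cos_le_one θ
  nlinarith [mul_pos (sub_pos.mpr hα1) (sub_pos.mpr hβ1),
    mul_nonneg (add_pos hα0 hβ0).le (sub_nonneg.mpr hc)]

theorem arg_div_star_ne_pi {w : ℂ} (hw : 0 < w.re) : (w / star w).arg ≠ Real.pi := by
  have hn : 0 < Complex.normSq w := by
    rw [Complex.normSq_apply]
    nlinarith [mul_self_nonneg w.im]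
  have h : w / star w = w ^ 2 * (((Complex.normSq w)⁻¹ : ℝ) : ℂ) := by
    rw [div_eq_mul_inv, Complex.inv_def]
    simp only [Complex.star_def, Complex.conj_conj, Complex.normSq_conj]
    ring
  intro hpi
  rw [Complex.arg_eq_pi_iff, h, Complex.re_mul_ofReal, Complex.im_mul_ofReal] at hpi
  obtain ⟨h1, h2⟩ := hpi
  have hi : 0 < (Complex.normSq w)⁻¹ := inv_pos.mpr hn
  have him : (w ^ 2).im = 0 := by
    rcases mul_eq_zero.mp h2 with h | h
    · exact h
    · exact absurd h hi.ne'
  have hre : (w ^ 2).re < 0 := by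
    by_contra hcon
    push Not at hcon
    exact absurd h1 (not_lt.mpr (mul_nonneg hcon hi.le))
  simp only [pow_two, Complex.mul_re, Complex.mul_im] at him hre
  have : w.im = 0 := by
    have : w.re * w.im = 0 := by linarith
    exact (mul_eq_zero.mp this).resolve_left hw.ne'
  rw [this] at hre
  nlinarith

theorem norm_cpow_two_inv {z : ℂ} (hz : ‖z‖ = 1) : ‖z ^ ((2 : ℂ)⁻¹)‖ = 1 := by
  have h : (z ^ ((2 : ℂ)⁻¹)) ^ 2 = z := Complex.cpow_nat_inv_pow z two_ne_zero
  have h2 : ‖z ^ ((2 : ℂ)⁻¹)‖ ^ 2 = 1 := by rw [← norm_pow, h, hz]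
  exact (pow_eq_one_iff_of_nonneg (norm_nonneg _) two_ne_zero).mp h2

theorem arg_cpow_two_inv_ne_pi (z : ℂ) : (z ^ ((2 : ℂ)⁻¹)).arg ≠ Real.pi := by
  intro h
  have h1 := (Complex.arg_eq_pi_iff.mp h).1
  rw [Complex.cpow_inv_two_re] at h1
  exact absurd h1 (not_lt.mpr (Real.sqrt_nonneg _))

theorem norm_sqb {α β θ : ℝ} (h : bnum α β θ ≠ 0) : ‖sqb α β θ‖ = 1 := by
  rw [sqb, bfun_eq]
  refine norm_cpow_two_inv (norm_cpow_two_inv ?_)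
  rw [norm_div, norm_star, div_self (norm_ne_zero_iff.mpr h)]

theorem sqb_two_pi_sub {α β θ : ℝ} (h : 0 < (bnum α β θ).re) :
    sqb α β (2 * Real.pi - θ) = (sqb α β θ)⁻¹ := by
  rw [sqb, sqb, bfun_eq, bfun_eq, bnum_two_pi_sub, star_star, ← inv_div,
    Complex.inv_cpow _ _ (arg_div_star_ne_pi h), Complex.inv_cpow _ _ (arg_cpow_two_inv_ne_pi _)]

theorem star_sqb {α β θ : ℝ} (h : bnum α β θ ≠ 0) : star (sqb α β θ) = (sqb α β θ)⁻¹ := by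
  rw [Complex.inv_eq_conj (norm_sqb h), Complex.star_def]

theorem thetaA_rev (N : ℕ) (k : Fin N) : thetaA N k.rev = 2 * Real.pi - thetaA N k := by
  have hk := k.isLt
  have hN0 : (N : ℝ) ≠ 0 := by
    exact_mod_cast (by omega : N ≠ 0)
  have hv : ((k.rev : ℕ) : ℝ) = N - (k + 1) := by
    rw [Fin.val_rev, Nat.cast_sub (by omega)]
    push_cast
    ring
  simp only [thetaA, hv]
  field_simp
  ring

theorem star_exp_neg_I_mul (l : ℤ) (x y : ℝ) :
    star (Complex.exp (-Complex.I * ((l : ℂ) - 2⁻¹) * ((x : ℂ) + y))) =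
      Complex.exp (Complex.I * ((l : ℂ) - 2⁻¹) * ((x : ℂ) + y)) := by
  rw [Complex.star_def, ← Complex.exp_conj]
  simp [Complex.conj_ofNat]

theorem Cmat_mul_star_add_Dmat_mul_star {N : ℕ} (hN : 1 ≤ N) (l : ℤ) {α β : ℝ}
    (hpos : ∀ θ, 0 < (bnum α β θ).re) (j m k : Fin N) :
    Cmat N l α β j k.rev * star (Cmat N l α β m k.rev) +
        Dmat N l α β j k * star (Dmat N l α β m k) =
      Complex.exp (-Complex.I * ((l : ℂ) - 2⁻¹) * ((thetaP N j : ℂ) - thetaP N m)) *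
        (sqb α β (thetaP N j) / sqb α β (thetaP N m) +
          sqb α β (thetaP N m) / sqb α β (thetaP N j)) / (2 * (N : ℂ) ^ 2) *
        ((Complex.sin (((thetaA N k : ℂ) - (thetaP N j : ℂ)) / 2))⁻¹ *
          (Complex.sin (((thetaA N k : ℂ) - (thetaP N m : ℂ)) / 2))⁻¹) := by
  have hne : ∀ θ, bnum α β θ ≠ 0 := fun θ h => by simpa [h] using hpos θ
  have hs0 : ∀ θ, sqb α β θ ≠ 0 := fun θ h => by simpa [h] using norm_sqb (hne θ)
  have hN0 : (N : ℂ) ≠ 0 := by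
    exact_mod_cast (by omega : N ≠ 0)
  have hsin : ∀ i : Fin N, Complex.sin (((thetaP N i : ℂ) + (thetaA N k.rev : ℂ)) / 2) =
      Complex.sin (((thetaA N k : ℂ) - (thetaP N i : ℂ)) / 2) := by
    intro i
    rw [thetaA_rev, ← Complex.sin_pi_sub]
    congr 1
    push_cast
    ring
  have hS := sin_half_thetaA_sub_thetaP_ne_zero N hN
  have hsinstar : ∀ i : Fin N,
      star (Complex.sin (((thetaA N k : ℂ) - (thetaP N i : ℂ)) / 2)) =
      Complex.sin (((thetaA N k : ℂ) - (thetaP N i : ℂ)) / 2) := by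
    intro i
    rw [Complex.star_def, ← Complex.sin_conj]
    simp [Complex.conj_ofNat]
  have h1 := hs0 (thetaP N j)
  have h2 := hs0 (thetaP N m)
  have h3 := hs0 (thetaA N k)
  have h4 := hS j k
  have h5 := hS m k
  have hEC : Complex.exp (-Complex.I * ((l : ℂ) - 2⁻¹) * ((thetaP N j : ℂ) - thetaP N m)) =
      Complex.exp (-Complex.I * ((l : ℂ) - 2⁻¹) * ((thetaP N j : ℂ) + thetaA N k.rev)) *
      star (Complex.exp (-Complex.I * ((l : ℂ) - 2⁻¹) *
        ((thetaP N m : ℂ) + thetaA N k.rev))) := by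
    rw [star_exp_neg_I_mul, ← Complex.exp_add]
    congr 1
    ring
  have hED : Complex.exp (-Complex.I * ((l : ℂ) - 2⁻¹) * ((thetaP N j : ℂ) - thetaP N m)) =
      Complex.exp (-Complex.I * ((l : ℂ) - 2⁻¹) * ((thetaP N j : ℂ) - thetaA N k)) *
      star (Complex.exp (-Complex.I * ((l : ℂ) - 2⁻¹) * ((thetaP N m : ℂ) - thetaA N k))) := by
    have := star_exp_neg_I_mul l (thetaP N m) (-thetaA N k)
    push_cast at this
    simp only [← sub_eq_add_neg] at this
    rw [this, ← Complex.exp_add]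
    congr 1
    ring
  have hsrev : sqb α β (thetaA N k.rev) = (sqb α β (thetaA N k))⁻¹ := by
    rw [thetaA_rev, sqb_two_pi_sub (hpos _)]
  have hI2 : star (2 * Complex.I * (N : ℂ)) = -(2 * Complex.I * N) := by
    simp
  have hC : Cmat N l α β j k.rev * star (Cmat N l α β m k.rev) =
      Complex.exp (-Complex.I * ((l : ℂ) - 2⁻¹) * ((thetaP N j : ℂ) - thetaP N m)) *
        ((sqb α β (thetaP N j) / sqb α β (thetaA N k) -
            sqb α β (thetaA N k) / sqb α β (thetaP N j)) *
          (sqb α β (thetaA N k) / sqb α β (thetaP N m) -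
            sqb α β (thetaP N m) / sqb α β (thetaA N k))) / (4 * (N : ℂ) ^ 2) *
        ((Complex.sin (((thetaA N k : ℂ) - (thetaP N j : ℂ)) / 2))⁻¹ *
          (Complex.sin (((thetaA N k : ℂ) - (thetaP N m : ℂ)) / 2))⁻¹) := by
    rw [hEC]
    simp only [Cmat, Matrix.of_apply, hsin, hsrev, star_mul', star_div₀, star_sub, star_inv₀,
      star_sqb (hne _), hsinstar, star_one, hI2]
    field_simp
    simp only [Complex.I_sq]
    field_simp
    ring
  have hD : Dmat N l α β j k * star (Dmat N l α β m k) =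
      Complex.exp (-Complex.I * ((l : ℂ) - 2⁻¹) * ((thetaP N j : ℂ) - thetaP N m)) *
        ((sqb α β (thetaA N k) / sqb α β (thetaP N j) +
            sqb α β (thetaP N j) / sqb α β (thetaA N k)) *
          (sqb α β (thetaP N m) / sqb α β (thetaA N k) +
            sqb α β (thetaA N k) / sqb α β (thetaP N m))) / (4 * (N : ℂ) ^ 2) *
        ((Complex.sin (((thetaA N k : ℂ) - (thetaP N j : ℂ)) / 2))⁻¹ *
          (Complex.sin (((thetaA N k : ℂ) - (thetaP N m : ℂ)) / 2))⁻¹) := by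
    rw [hED]
    simp only [Dmat, Matrix.of_apply, star_mul', star_div₀, star_add,
      star_sqb (hne _), hsinstar, hI2]
    field_simp
    simp only [Complex.I_sq]
    field_simp
    ring
  rw [hC, hD]
  field_simp
  ring

theorem CCdag_eq_one_sub_DDdag
    (N : ℕ) (hN : 1 ≤ N) (l : ℤ) (Kx Ky Kxs : ℝ)
    (hKx : 0 < Kx) (hKy : 0 < Ky)
    (hKxs_pos : 0 < Kxs) (hKxs : Real.tanh Kxs = Real.exp (-(2 * Kx)))
    (α β : ℝ)
    (hα : α = Real.tanh Kxs * (Real.cosh Ky / Real.sinh Ky))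
    (hβ : β = Real.tanh Kxs * Real.tanh Ky)
    (hferro : Kxs < Ky) :
    Cmat N l α β * (Cmat N l α β)ᴴ = 1 - Dmat N l α β * (Dmat N l α β)ᴴ := by
  have htx : 0 < Real.tanh Kxs := by
    simpa using tanh_strictMono hKxs_pos
  have hty : 0 < Real.tanh Ky := by
    simpa using tanh_strictMono hKy
  have hα' : α = Real.tanh Kxs / Real.tanh Ky := by
    rw [hα, Real.tanh_eq_sinh_div_cosh Ky, div_eq_mul_inv (Real.tanh Kxs), inv_div]
  have hα0 : 0 < α := hα' ▸ div_pos htx hty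
  have hα1 : α < 1 := by
    rw [hα', div_lt_one hty]
    exact tanh_strictMono hferro
  have hβ0 : 0 < β := hβ ▸ mul_pos htx hty
  have hβ1 : β < 1 := by
    rw [hβ]
    exact mul_lt_one_of_nonneg_of_lt_one_left htx.le (Real.tanh_lt_one _) (Real.tanh_lt_one _).le
  have hpos := bnum_re_pos hα0 hα1 hβ0 hβ1
  have hs0 : ∀ θ, sqb α β θ ≠ 0 := fun θ h => by
    have hne : bnum α β θ ≠ 0 := fun h => by simpa [h] using hpos θ
    simpa [h] using norm_sqb hne
  have hN0 : (N : ℂ) ≠ 0 := by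
    exact_mod_cast (by omega : N ≠ 0)
  rw [eq_sub_iff_add_eq]
  ext j m
  simp only [Matrix.add_apply, Matrix.mul_apply, Matrix.conjTranspose_apply]
  rw [← Equiv.sum_comp Fin.revPerm
    (fun k => Cmat N l α β j k * star (Cmat N l α β m k)), ← Finset.sum_add_distrib]
  simp only [Fin.revPerm_apply, Cmat_mul_star_add_Dmat_mul_star hN l hpos j m]
  rw [← Finset.mul_sum, sum_inv_sin_mul_inv_sin N hN, Matrix.one_apply]
  split_ifs with h
  · subst h
    rw [div_self (hs0 _), sub_self, mul_zero, Complex.exp_zero]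
    field_simp
    norm_num
  · rw [mul_zero]
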